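/- Let d ∈ {2,3}, μ > 0 and N ∈ ℕ. For a smooth ℤ^d-periodic vector field u : ℝ^d → ℝ^d set ‖u‖_{L⁴} := (∫_Q ‖u(x)‖⁴ dx)^{1/4} and define the quantization factor θ_N(u) := 1 if ‖u‖_{L⁴} ≤ N and θ_N(u) := (N/‖u‖_{L⁴})⁴ otherwise. Then there exists a constant C > 0 (depending only on d, μ and N) such that for all smooth ℤ^d-periodic divergence-free vector fields y, z : ℝ^d → ℝ^d one has | θ_N(y)·∫_Q ⟨((y·∇)y)(x), y(x) − z(x)⟩ dx − θ_N(z)·∫_Q ⟨((z·∇)z)(x), y(x) − z(x)⟩ dx | ≤ (μ/2)·∫_Q ‖Dy(x) − Dz(x)‖_F² dx + C·∫_Q ‖y(x) − z(x)‖² dx, where Q = [0,1]^d. -/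

import Mathlib

open MeasureTheory RealInnerProductSpace

noncomputable section

/-- The unit periodicity cell `Q = [0,1]^d` in `ℝ^d`. -/
def unitCube (d : ℕ) : Set (EuclideanSpace ℝ (Fin d)) :=
  {x | ∀ i, x i ∈ Set.Icc (0 : ℝ) 1}

/-- A vector field `u : ℝ^d → ℝ^d` is `ℤ^d`-periodic if `u(x + k) = u(x)`
for all `x ∈ ℝ^d` and `k ∈ ℤ^d`. -/
def IsZdPeriodic {d : ℕ} (u : EuclideanSpace ℝ (Fin d) → EuclideanSpace ℝ (Fin d)) : Prop :=
  ∀ (x : EuclideanSpace ℝ (Fin d)) (k : Fin d → ℤ),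
    u (x + (WithLp.equiv 2 (Fin d → ℝ)).symm (fun i => (k i : ℝ))) = u x

/-- A vector field `u : ℝ^d → ℝ^d` is divergence-free if `∑ i ∂ᵢ uᵢ(x) = 0` for all `x`. -/
def IsDivFree {d : ℕ} (u : EuclideanSpace ℝ (Fin d) → EuclideanSpace ℝ (Fin d)) : Prop :=
  ∀ x : EuclideanSpace ℝ (Fin d),
    ∑ i, fderiv ℝ u x (EuclideanSpace.single i 1) i = 0

/-- The squared Frobenius (Hilbert–Schmidt) norm of a linear map `ℝ^d → ℝ^d`,
as the sum of the squared Euclidean norms of its columns. -/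
def frobSq {d : ℕ} (L : EuclideanSpace ℝ (Fin d) →L[ℝ] EuclideanSpace ℝ (Fin d)) : ℝ :=
  ∑ j, ‖L (EuclideanSpace.single j 1)‖ ^ 2

/-- The `L⁴` norm `‖u‖_{L⁴} = (∫_Q ‖u(x)‖⁴ dx)^{1/4}` of a vector field over the
periodicity cell `Q = [0,1]^d`. -/
def L4NormQ {d : ℕ} (u : EuclideanSpace ℝ (Fin d) → EuclideanSpace ℝ (Fin d)) : ℝ :=
  (∫ x in unitCube d, ‖u x‖ ^ 4) ^ ((1 : ℝ) / 4)

/-- The `L⁴`-quantization factor `θ_N(u)`: equal to `1` if `‖u‖_{L⁴} ≤ N` and to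
`(N/‖u‖_{L⁴})⁴` otherwise. -/
def quantFactor {d : ℕ} (N : ℕ)
    (u : EuclideanSpace ℝ (Fin d) → EuclideanSpace ℝ (Fin d)) : ℝ :=
  if L4NormQ u ≤ N then 1 else ((N : ℝ) / L4NormQ u) ^ 4

lemma unitCube_eq_preimage (d : ℕ) :
    unitCube d = (WithLp.ofLp : EuclideanSpace ℝ (Fin d) → Fin d → ℝ) ⁻¹' Set.Icc 0 1 := by
  ext x
  simp [unitCube, Set.mem_Icc, Pi.le_def, forall_and]

lemma isCompact_unitCube (d : ℕ) : IsCompact (unitCube d) := by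
  rw [unitCube_eq_preimage]
  exact (PiLp.homeomorph 2 (fun _ : Fin d => ℝ)).isCompact_preimage.2 isCompact_Icc

lemma integrableOn_unitCube {d : ℕ} {F : Type*} [NormedAddCommGroup F]
    {f : EuclideanSpace ℝ (Fin d) → F} (hf : Continuous f) : IntegrableOn f (unitCube d) :=
  hf.continuousOn.integrableOn_compact (isCompact_unitCube d)

/-- Integrals over the unit cell in coordinates. -/
lemma setIntegral_unitCube {d : ℕ} (f : EuclideanSpace ℝ (Fin d) → ℝ) :
    ∫ x in unitCube d, f x = ∫ x in Set.Icc (0 : Fin d → ℝ) 1, f (WithLp.toLp 2 x) := by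
  have h := (PiLp.volume_preserving_ofLp (Fin d)).setIntegral_preimage_emb
    (MeasurableEquiv.toLp 2 (Fin d → ℝ)).symm.measurableEmbedding
    (fun x => f (WithLp.toLp 2 x)) (Set.Icc 0 1)
  rw [unitCube_eq_preimage]
  simpa using h

lemma memLp_unitCube {d : ℕ} {F : Type*} [NormedAddCommGroup F]
    {f : EuclideanSpace ℝ (Fin d) → F} (hf : Continuous f) (p : ENNReal) :
    MemLp f p (volume.restrict (unitCube d)) := by
  have hK := isCompact_unitCube d
  have : IsFiniteMeasure (volume.restrict (unitCube d)) :=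
    isFiniteMeasure_restrict.2 hK.measure_ne_top
  obtain ⟨C, hC⟩ := hK.exists_bound_of_continuousOn hf.continuousOn
  exact .of_bound (integrableOn_unitCube hf).aestronglyMeasurable C
    (ae_restrict_of_forall_mem hK.measurableSet hC)

/-- The Cauchy–Schwarz inequality on the unit cell. -/
lemma integral_mul_le_sqrt_mul_sqrt {d : ℕ} {f g : EuclideanSpace ℝ (Fin d) → ℝ}
    (hf : Continuous f) (hg : Continuous g) (hf0 : ∀ x, 0 ≤ f x) (hg0 : ∀ x, 0 ≤ g x) :
    ∫ x in unitCube d, f x * g x ≤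
      √(∫ x in unitCube d, f x ^ 2) * √(∫ x in unitCube d, g x ^ 2) := by
  have h := integral_mul_le_Lp_mul_Lq_of_nonneg (μ := volume.restrict (unitCube d))
    Real.HolderConjugate.two_two (.of_forall hf0) (.of_forall hg0)
    (memLp_unitCube hf _) (memLp_unitCube hg _)
  simpa [Real.sqrt_eq_rpow] using h

/-- A continuous function on the real line is controlled on `[0,1]` by its `W^{1,1}` norm. -/
lemma abs_le_integral_abs_add {φ φ' k : ℝ → ℝ} (hφ : ∀ t, HasDerivAt φ (φ' t) t)
    (hφ' : Continuous φ') (hk : Continuous k) (hle : ∀ t, |φ' t| ≤ k t) {s : ℝ}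
    (hs : s ∈ Set.Icc (0 : ℝ) 1) : |φ s| ≤ ∫ t in Set.Icc (0 : ℝ) 1, (|φ t| + k t) := by
  have hc : Continuous φ := continuous_iff_continuousAt.2 fun t => (hφ t).continuousAt
  have hk0 : ∀ t, 0 ≤ k t := fun t => (abs_nonneg _).trans (hle t)
  have hkI : IntegrableOn k (Set.Icc 0 1) := hk.continuousOn.integrableOn_compact isCompact_Icc
  have hφI : IntegrableOn (fun t => |φ t|) (Set.Icc 0 1) :=
    hc.abs.continuousOn.integrableOn_compact isCompact_Icc
  have hdiff : ∀ t ∈ Set.Icc (0 : ℝ) 1, |φ s| ≤ |φ t| + ∫ r in Set.Icc (0 : ℝ) 1, k r := by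
    intro t ht
    have hftc : ∫ r in t..s, φ' r = φ s - φ t :=
      intervalIntegral.integral_eq_sub_of_hasDerivAt (fun r _ => hφ r)
        (hφ'.intervalIntegrable _ _)
    have hbound : |φ s - φ t| ≤ ∫ r in Set.Icc (0 : ℝ) 1, k r := by
      rw [← hftc, ← Real.norm_eq_abs]
      refine (intervalIntegral.norm_integral_le_integral_norm_uIoc).trans ?_
      calc ∫ r in Set.uIoc t s, ‖φ' r‖ ≤ ∫ r in Set.uIoc t s, k r :=
            setIntegral_mono (hφ'.norm.integrableOn_uIoc) (hk.integrableOn_uIoc) hle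
        _ ≤ ∫ r in Set.Icc (0 : ℝ) 1, k r := by
            refine setIntegral_mono_set hkI (.of_forall hk0) (LE.le.eventuallyLE ?_)
            exact Set.uIoc_subset_uIcc.trans (Set.ordConnected_Icc.uIcc_subset ht hs)
    linarith [abs_sub_abs_le_abs_sub (φ s) (φ t)]
  have hvol : volume.real (Set.Icc (0 : ℝ) 1) = 1 := by simp
  have hmono := setIntegral_mono_on (μ := volume) (integrableOn_const (by simp))
    (hφI.add (integrableOn_const (by simp))) measurableSet_Icc hdiff
  rw [setIntegral_const, integral_add' hφI (integrable_const _), setIntegral_const, hvol,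
    one_smul, one_smul] at hmono
  rwa [integral_add hφI hkI]

/-- The Gagliardo–Nirenberg inequality for the embedding of `W^{1,1}` into `L^{d/(d-1)}`
on the unit cell. -/
lemma integral_abs_rpow_le_rpow_integral {d : ℕ} {p : ℝ} (hp : Real.HolderConjugate d p)
    {g h : EuclideanSpace ℝ (Fin d) → ℝ} (hg : ContDiff ℝ 1 g) (hh : Continuous h)
    (hle : ∀ x i, |fderiv ℝ g x (EuclideanSpace.single i 1)| ≤ h x) :
    ∫ x in unitCube d, |g x| ^ p ≤ (∫ x in unitCube d, (|g x| + h x)) ^ p := by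
  have hd1 : (1 : ℝ) < d := hp.lt
  have hp0 : 0 < p := hp.symm.pos
  have hpd : p = d * (1 / ((d : ℝ) - 1)) := by
    rw [hp.conjugate_eq]; ring
  have : Nonempty (Fin d) := ⟨⟨0, by
    rcases Nat.eq_zero_or_pos d with rfl | h
    · norm_num at hd1
    · exact h⟩⟩
  have hh0 : ∀ x, 0 ≤ h x := fun x => (abs_nonneg _).trans (hle x (Classical.arbitrary _))
  rw [setIntegral_unitCube (fun x => |g x| ^ p), setIntegral_unitCube (fun x => |g x| + h x)]
  have hgc : Continuous g := hg.continuous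
  set f : (Fin d → ℝ) → ℝ := fun x => |g (WithLp.toLp 2 x)| + h (WithLp.toLp 2 x) with hf
  have hfc : Continuous f := by fun_prop
  have hf0 : ∀ x, 0 ≤ f x := fun x => add_nonneg (abs_nonneg _) (hh0 _)
  set ν : Measure (Fin d → ℝ) := volume.restrict (Set.Icc 0 1) with hν
  have hνpi : ν = Measure.pi fun _ : Fin d => volume.restrict (Set.Icc (0 : ℝ) 1) := by
    rw [← Measure.restrict_pi_pi, Set.pi_univ_Icc, hν, volume_pi]; rfl
  have hline : ∀ x ∈ Set.Icc (0 : Fin d → ℝ) 1, ∀ i, ENNReal.ofReal |g (WithLp.toLp 2 x)| ≤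
      ∫⁻ t in Set.Icc (0 : ℝ) 1, ENNReal.ofReal (f (Function.update x i t)) := by
    intro x hx i
    have hu : ∀ t, HasDerivAt (fun t => WithLp.toLp 2 (Function.update x i t))
        (EuclideanSpace.single i (1 : ℝ)) t := by
      intro t
      exact (PiLp.continuousLinearEquiv 2 ℝ (fun _ : Fin d => ℝ)).symm.hasFDerivAt.comp_hasDerivAt t
        (hasDerivAt_update x i t)
    have huc : Continuous fun t => WithLp.toLp 2 (Function.update x i t) :=
      continuous_iff_continuousAt.2 fun t => (hu t).continuousAt
    have hderiv : ∀ t, HasDerivAt (fun t => g (WithLp.toLp 2 (Function.update x i t)))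
        (fderiv ℝ g (WithLp.toLp 2 (Function.update x i t)) (EuclideanSpace.single i 1)) t :=
      fun t => ((hg.differentiable one_ne_zero) _).hasFDerivAt.comp_hasDerivAt t (hu t)
    have hxi : x i ∈ Set.Icc (0 : ℝ) 1 := ⟨hx.1 i, hx.2 i⟩
    have h1 := abs_le_integral_abs_add hderiv
      (((hg.continuous_fderiv one_ne_zero).comp huc).clm_apply continuous_const)
      (hh.comp huc) (fun t => hle _ i) hxi
    rw [Function.update_eq_self] at h1
    rw [← ofReal_integral_eq_lintegral_ofReal]
    · exact ENNReal.ofReal_le_ofReal h1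
    · exact (hfc.comp (by fun_prop)).continuousOn.integrableOn_compact isCompact_Icc
    · exact .of_forall fun t => hf0 _
  have hgrid := lintegral_prod_lintegral_pow_le
    (fun _ : Fin d => volume.restrict (Set.Icc (0 : ℝ) 1)) (p := p) (by simpa using hp)
    (f := fun x => ENNReal.ofReal (f x)) (by fun_prop)
  rw [← hνpi] at hgrid
  have hpt : ∫⁻ x, ENNReal.ofReal (|g (WithLp.toLp 2 x)| ^ p) ∂ν ≤
      (∫⁻ x, ENNReal.ofReal (f x) ∂ν) ^ p := by
    refine le_trans (setLIntegral_mono' measurableSet_Icc fun x hx => ?_) hgrid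
    rw [← ENNReal.ofReal_rpow_of_nonneg (abs_nonneg _) hp0.le]
    calc ENNReal.ofReal |g (WithLp.toLp 2 x)| ^ p
        = ∏ _i : Fin d, ENNReal.ofReal |g (WithLp.toLp 2 x)| ^ (1 / ((d : ℝ) - 1)) := by
          rw [Finset.prod_const, Finset.card_univ, Fintype.card_fin, ← ENNReal.rpow_natCast,
            ← ENNReal.rpow_mul, mul_comm, ← hpd]
      _ ≤ _ := by
          rw [Fintype.card_fin]
          refine Finset.prod_le_prod' fun i _ => ENNReal.rpow_le_rpow (hline x hx i) ?_
          exact one_div_nonneg.2 (by linarith)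
  have hfI : Integrable f ν := hfc.continuousOn.integrableOn_compact isCompact_Icc
  have hgI : Integrable (fun x => |g (WithLp.toLp 2 x)| ^ p) ν := by
    refine Continuous.integrableOn_Icc ?_
    exact Continuous.rpow_const (by fun_prop) fun _ => .inr hp0.le
  rw [← ofReal_integral_eq_lintegral_ofReal hgI (.of_forall fun x => by positivity),
    ← ofReal_integral_eq_lintegral_ofReal hfI (.of_forall hf0),
    ENNReal.ofReal_rpow_of_nonneg (integral_nonneg hf0) hp0.le] at hpt
  exact (ENNReal.ofReal_le_ofReal_iff (Real.rpow_nonneg (integral_nonneg hf0) _)).1 hpt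

lemma frobSq_nonneg {d : ℕ} (L : EuclideanSpace ℝ (Fin d) →L[ℝ] EuclideanSpace ℝ (Fin d)) :
    0 ≤ frobSq L :=
  Finset.sum_nonneg fun _ _ => sq_nonneg _

lemma continuous_frobSq {d : ℕ} : Continuous (frobSq (d := d)) := by
  unfold frobSq
  fun_prop

lemma norm_apply_single_le_sqrt_frobSq {d : ℕ}
    (L : EuclideanSpace ℝ (Fin d) →L[ℝ] EuclideanSpace ℝ (Fin d)) (i : Fin d) :
    ‖L (EuclideanSpace.single i 1)‖ ≤ √(frobSq L) :=
  Real.le_sqrt_of_sq_le <| Finset.single_le_sum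
    (f := fun j => ‖L (EuclideanSpace.single j 1)‖ ^ 2) (fun _ _ => sq_nonneg _)
    (Finset.mem_univ i)

lemma norm_apply_le_sqrt_frobSq_mul {d : ℕ}
    (L : EuclideanSpace ℝ (Fin d) →L[ℝ] EuclideanSpace ℝ (Fin d)) (v : EuclideanSpace ℝ (Fin d)) :
    ‖L v‖ ≤ √(frobSq L) * ‖v‖ := by
  have hv : v = ∑ i, v i • EuclideanSpace.single i (1 : ℝ) := by
    simpa using ((EuclideanSpace.basisFun (Fin d) ℝ).sum_repr v).symm
  calc ‖L v‖ = ‖∑ i, v i • L (EuclideanSpace.single i 1)‖ := by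
        conv_lhs => rw [hv, map_sum]
        simp only [map_smul]
    _ ≤ ∑ i, ‖L (EuclideanSpace.single i 1)‖ * ‖v i‖ := by
        refine (norm_sum_le _ _).trans (Finset.sum_le_sum fun i _ => ?_)
        rw [norm_smul, mul_comm]
    _ ≤ √(∑ i, ‖L (EuclideanSpace.single i 1)‖ ^ 2) * √(∑ i, ‖v i‖ ^ 2) :=
        Real.sum_mul_le_sqrt_mul_sqrt _ _ _
    _ = √(frobSq L) * ‖v‖ := by rw [EuclideanSpace.norm_eq]; rfl

/-- **Ladyzhenskaya's inequality** on the unit cell in dimension two and three. -/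
lemma integral_norm_pow_four_le {d : ℕ} (hd : d = 2 ∨ d = 3)
    {w : EuclideanSpace ℝ (Fin d) → EuclideanSpace ℝ (Fin d)} (hw : ContDiff ℝ 1 w) :
    ∫ x in unitCube d, ‖w x‖ ^ 4 ≤ √(∫ x in unitCube d, ‖w x‖ ^ 2) *
      (√(∫ x in unitCube d, ‖w x‖ ^ 2) + 4 * √(∫ x in unitCube d, frobSq (fderiv ℝ w x))) ^ 3 := by
  set W := √(∫ x in unitCube d, ‖w x‖ ^ 2) with hW
  set G := √(∫ x in unitCube d, frobSq (fderiv ℝ w x)) with hG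
  have hW0 : 0 ≤ W := Real.sqrt_nonneg _
  have hG0 : 0 ≤ G := Real.sqrt_nonneg _
  have hwc : Continuous w := hw.continuous
  have hdc : Continuous (fderiv ℝ w) := hw.continuous_fderiv one_ne_zero
  have hFc : Continuous fun x => √(frobSq (fderiv ℝ w x)) := (continuous_frobSq.comp hdc).sqrt
  have hF : ∫ x in unitCube d, √(frobSq (fderiv ℝ w x)) ^ 2 =
      ∫ x in unitCube d, frobSq (fderiv ℝ w x) := by
    simp only [Real.sq_sqrt (frobSq_nonneg _)]
  have hsq : ∀ x, HasFDerivAt (fun x => ‖w x‖ ^ 2)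
      (2 • (innerSL ℝ (w x)).comp (fderiv ℝ w x)) x := fun x =>
    (hw.differentiable one_ne_zero x).hasFDerivAt.norm_sq
  have hinner : ∀ x i, |⟪w x, fderiv ℝ w x (EuclideanSpace.single i 1)⟫| ≤
      ‖w x‖ * √(frobSq (fderiv ℝ w x)) := fun x i =>
    (abs_real_inner_le_norm _ _).trans
      (mul_le_mul_of_nonneg_left (norm_apply_single_le_sqrt_frobSq _ _) (norm_nonneg _))
  rcases hd with rfl | rfl
  · have h := integral_abs_rpow_le_rpow_integral (d := 2) (p := 2)
      (by exact_mod_cast Real.HolderConjugate.two_two)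
      (g := fun x => ‖w x‖ ^ 2) (h := fun x => ‖w x‖ * (2 * √(frobSq (fderiv ℝ w x))))
      (hw.norm_sq ℝ) (by fun_prop) (fun x i => by
        rw [(hsq x).fderiv]
        simp only [smul_apply, ContinuousLinearMap.comp_apply,
          innerSL_apply_apply, nsmul_eq_mul, abs_mul]
        norm_num
        linarith [hinner x i])
    have e1 : ∀ x, |‖w x‖ ^ 2| ^ (2 : ℝ) = ‖w x‖ ^ 4 := fun x => by
      rw [Real.rpow_two, sq_abs]; ring
    have hcs := integral_mul_le_sqrt_mul_sqrt hwc.norm hFc (fun _ => norm_nonneg _)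
      (fun _ => Real.sqrt_nonneg _)
    rw [hF] at hcs
    have e2 : ∫ x in unitCube 2, (|‖w x‖ ^ 2| + ‖w x‖ * (2 * √(frobSq (fderiv ℝ w x)))) =
        W ^ 2 + 2 * ∫ x in unitCube 2, ‖w x‖ * √(frobSq (fderiv ℝ w x)) := by
      rw [integral_add (integrableOn_unitCube (by fun_prop)) (integrableOn_unitCube (by fun_prop)),
        hW, Real.sq_sqrt (integral_nonneg fun _ => by positivity), ← integral_const_mul]
      simp only [abs_pow, abs_norm]
      congr 2
      ext x; ring
    simp only [e1, e2, Real.rpow_two] at h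
    have hT0 : 0 ≤ ∫ x in unitCube 2, ‖w x‖ * √(frobSq (fderiv ℝ w x)) :=
      integral_nonneg fun _ => by positivity
    calc _ ≤ (W ^ 2 + 2 * ∫ x in unitCube 2, ‖w x‖ * √(frobSq (fderiv ℝ w x))) ^ 2 := h
      _ ≤ (W * (W + 4 * G)) ^ 2 := by
          gcongr
          nlinarith [mul_nonneg hW0 hG0]
      _ = (W * (W + 4 * G) ^ 2) * W := by ring
      _ ≤ (W * (W + 4 * G) ^ 2) * (W + 4 * G) := by gcongr; linarith
      _ = _ := by ring
  · set S := ∫ x in unitCube 3, ‖w x‖ ^ 6 with hS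
    have hS0 : 0 ≤ S := integral_nonneg fun _ => by positivity
    have hwc3 : Continuous fun x => ‖w x‖ ^ 3 := by fun_prop
    have hcube : ∫ x in unitCube 3, (‖w x‖ ^ 3) ^ 2 = S := by simp only [← pow_mul, hS]
    have h := integral_abs_rpow_le_rpow_integral (d := 3) (p := 3 / 2)
      (by rw [Real.holderConjugate_iff]; norm_num)
      (g := fun x => (‖w x‖ ^ 2) ^ 2) (h := fun x => ‖w x‖ ^ 3 * (4 * √(frobSq (fderiv ℝ w x))))
      ((hw.norm_sq ℝ).pow 2) (by fun_prop) (fun x i => by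
        rw [((hsq x).pow 2).fderiv]
        simp only [smul_apply, ContinuousLinearMap.comp_apply,
          innerSL_apply_apply, nsmul_eq_mul, smul_eq_mul, abs_mul]
        norm_num
        nlinarith [mul_le_mul_of_nonneg_left (hinner x i) (sq_nonneg ‖w x‖)])
    have e1 : ∀ x, |(‖w x‖ ^ 2) ^ 2| ^ (3 / 2 : ℝ) = ‖w x‖ ^ 6 := fun x => by
      rw [abs_of_nonneg (by positivity), ← Real.rpow_natCast, ← Real.rpow_natCast,
        ← Real.rpow_natCast, ← Real.rpow_mul (norm_nonneg _), ← Real.rpow_mul (norm_nonneg _)]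
      norm_num
    have hcs := integral_mul_le_sqrt_mul_sqrt hwc3 hFc (fun _ => by positivity)
      (fun _ => Real.sqrt_nonneg _)
    have hcs' := integral_mul_le_sqrt_mul_sqrt hwc.norm hwc3 (fun _ => norm_nonneg _)
      (fun _ => by positivity)
    rw [hcube, hF] at hcs
    rw [hcube] at hcs'
    have e3 : ∀ x, ‖w x‖ * ‖w x‖ ^ 3 = ‖w x‖ ^ 4 := fun x => by ring
    simp only [e3] at hcs'
    have e2 : ∫ x in unitCube 3, (|(‖w x‖ ^ 2) ^ 2| + ‖w x‖ ^ 3 * (4 * √(frobSq (fderiv ℝ w x)))) =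
        (∫ x in unitCube 3, ‖w x‖ ^ 4) +
          4 * ∫ x in unitCube 3, ‖w x‖ ^ 3 * √(frobSq (fderiv ℝ w x)) := by
      rw [integral_add (integrableOn_unitCube (by fun_prop)) (integrableOn_unitCube (by fun_prop)),
        ← integral_const_mul]
      simp only [abs_pow, abs_norm]
      congr 2 <;> ext x <;> ring
    simp only [e1, e2] at h
    have hT0 : 0 ≤ ∫ x in unitCube 3, ‖w x‖ ^ 3 * √(frobSq (fderiv ℝ w x)) :=
      integral_nonneg fun _ => by positivity
    have hV0 : 0 ≤ ∫ x in unitCube 3, ‖w x‖ ^ 4 := integral_nonneg fun _ => by positivity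
    set s := √S with hs
    have hs0 : 0 ≤ s := Real.sqrt_nonneg _
    have hsS : s ^ 2 = S := Real.sq_sqrt hS0
    set T := (∫ x in unitCube 3, ‖w x‖ ^ 4) +
      4 * ∫ x in unitCube 3, ‖w x‖ ^ 3 * √(frobSq (fderiv ℝ w x)) with hT
    have hT0' : 0 ≤ T := by positivity
    have hTle : T ≤ s * (W + 4 * G) := by rw [hT]; linarith
    have hST : S ^ 2 ≤ T ^ 3 := by
      have h2 := pow_le_pow_left₀ hS0 h 2
      rwa [← Real.rpow_natCast (T ^ (3 / 2 : ℝ)), ← Real.rpow_mul hT0',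
        show (3 / 2 : ℝ) * (2 : ℕ) = (3 : ℕ) by norm_num, Real.rpow_natCast] at h2
    have hsle : s ≤ (W + 4 * G) ^ 3 := by
      rcases hs0.eq_or_lt with h0 | h0
      · rw [← h0]; positivity
      · refine le_of_mul_le_mul_left ?_ (pow_pos h0 3)
        calc s ^ 3 * s = S ^ 2 := by rw [← hsS]; ring
          _ ≤ T ^ 3 := hST
          _ ≤ (s * (W + 4 * G)) ^ 3 := by gcongr
          _ = _ := by ring
    exact hcs'.trans (mul_le_mul_of_nonneg_left hsle hW0)

/-- The divergence of a periodic vector field has zero mean. -/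
lemma integral_divergence_eq_zero {d : ℕ} {F : EuclideanSpace ℝ (Fin d) → EuclideanSpace ℝ (Fin d)}
    (hF : ContDiff ℝ 1 F) (hper : IsZdPeriodic F) :
    ∫ x in unitCube d, ∑ i, fderiv ℝ F x (EuclideanSpace.single i 1) i = 0 := by
  rcases d with _ | n
  · simp
  let e := (PiLp.continuousLinearEquiv 2 ℝ (fun _ : Fin (n + 1) => ℝ))
  let L : Fin (n + 1) → (Fin (n + 1) → ℝ) → (Fin (n + 1) → ℝ) →L[ℝ] ℝ := fun i x =>
    (EuclideanSpace.proj i).comp ((fderiv ℝ F (e.symm x)).comp (e.symm : (Fin (n + 1) → ℝ) →L[ℝ] _))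
  have hL : ∀ x i, HasFDerivAt (fun x => F (e.symm x) i) (L i x) x := fun x i =>
    (EuclideanSpace.proj i : EuclideanSpace ℝ (Fin (n + 1)) →L[ℝ] ℝ).hasFDerivAt.comp x
      (((hF.differentiable one_ne_zero) _).hasFDerivAt.comp x e.symm.hasFDerivAt)
  have hLapp : ∀ x i, L i x (Pi.single i 1) =
      fderiv ℝ F (WithLp.toLp 2 x) (EuclideanSpace.single i 1) i := fun x i => rfl
  have hdc : Continuous (fderiv ℝ F) := hF.continuous_fderiv one_ne_zero
  have h := integral_divergence_of_hasFDerivAt_off_countable' (0 : Fin (n + 1) → ℝ) 1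
    zero_le_one (fun i x => F (e.symm x) i) L ∅ Set.countable_empty
    (fun i => (continuous_iff_continuousAt.2 fun x => (hL x i).continuousAt).continuousOn)
    (fun x _ i => hL x i)
    (by
      simp only [hLapp]
      refine Continuous.integrableOn_Icc ?_
      fun_prop)
  simp only [hLapp] at h
  rw [setIntegral_unitCube, h]
  refine Finset.sum_eq_zero fun i _ => sub_eq_zero.2 ?_
  refine integral_congr_ae (.of_forall fun x => ?_)
  have hp := hper (WithLp.toLp 2 (Fin.insertNth i (0 : ℝ) x)) (Pi.single i 1)
  have hx : WithLp.toLp 2 (Fin.insertNth i (0 : ℝ) x) +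
      (WithLp.equiv 2 (Fin (n + 1) → ℝ)).symm (fun j => ((Pi.single i 1 : Fin (n + 1) → ℤ) j : ℝ)) =
      WithLp.toLp 2 (Fin.insertNth i (1 : ℝ) x) := by
    ext j
    refine Fin.succAboveCases i ?_ (fun j => ?_) j <;> simp
  rw [hx] at hp
  exact congrArg (fun v => v i) hp

/-- Antisymmetry of the trilinear convective form in its last two arguments. -/
lemma integral_inner_convective_swap {d : ℕ}
    {u v w : EuclideanSpace ℝ (Fin d) → EuclideanSpace ℝ (Fin d)}
    (hu : ContDiff ℝ 1 u) (hv : ContDiff ℝ 1 v) (hw : ContDiff ℝ 1 w)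
    (pu : IsZdPeriodic u) (pv : IsZdPeriodic v) (pw : IsZdPeriodic w) (du : IsDivFree u) :
    (∫ x in unitCube d, ⟪fderiv ℝ v x (u x), w x⟫) =
      -∫ x in unitCube d, ⟪fderiv ℝ w x (u x), v x⟫ := by
  have h := integral_divergence_eq_zero (F := fun x => ⟪v x, w x⟫ • u x)
    ((hv.inner ℝ hw).smul hu) (fun x k => by simp only [pu x k, pv x k, pw x k])
  have hc : ∀ {a b c : EuclideanSpace ℝ (Fin d) → EuclideanSpace ℝ (Fin d)}, Continuous a →
      ContDiff ℝ 1 b → Continuous c →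
      IntegrableOn (fun x => ⟪fderiv ℝ b x (a x), c x⟫) (unitCube d) := fun ha hb hc =>
    integrableOn_unitCube (((hb.continuous_fderiv one_ne_zero).clm_apply ha).inner hc)
  rw [eq_neg_iff_add_eq_zero, ← integral_add (hc hu.continuous hv hw.continuous)
    (hc hu.continuous hw hv.continuous), ← h]
  refine integral_congr_ae (.of_forall fun x => ?_)
  have hu' := (hu.differentiable one_ne_zero x).hasFDerivAt
  have hv' := (hv.differentiable one_ne_zero x).hasFDerivAt
  have hw' := (hw.differentiable one_ne_zero x).hasFDerivAt
  have hux : u x = ∑ i, u x i • EuclideanSpace.single i (1 : ℝ) := by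
    simpa using ((EuclideanSpace.basisFun (Fin d) ℝ).sum_repr (u x)).symm
  have hlin : ∀ (M : EuclideanSpace ℝ (Fin d) →L[ℝ] EuclideanSpace ℝ (Fin d)) a,
      ⟪M (u x), a⟫ = ∑ i, u x i * ⟪M (EuclideanSpace.single i 1), a⟫ := by
    intro M a
    conv_lhs => rw [hux, map_sum, sum_inner]
    simp only [map_smul, inner_smul_left]
    rfl
  have hderiv : HasFDerivAt (fun x => ⟪v x, w x⟫ • u x) _ x := (hv'.inner ℝ hw').fun_smul hu'
  beta_reduce
  rw [hderiv.fderiv]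
  have hdiv := du x
  simp only [hlin]
  simp [fderivInnerCLM_apply, Finset.sum_add_distrib, ← Finset.mul_sum, hdiv]
  rw [← Finset.sum_add_distrib]
  refine Finset.sum_congr rfl fun i _ => ?_
  rw [real_inner_comm (v x)]
  ring

lemma L4NormQ_nonneg {d : ℕ} (u : EuclideanSpace ℝ (Fin d) → EuclideanSpace ℝ (Fin d)) :
    0 ≤ L4NormQ u :=
  Real.rpow_nonneg (integral_nonneg fun _ => by positivity) _

lemma L4NormQ_pow_four {d : ℕ} (u : EuclideanSpace ℝ (Fin d) → EuclideanSpace ℝ (Fin d)) :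
    L4NormQ u ^ 4 = ∫ x in unitCube d, ‖u x‖ ^ 4 := by
  rw [L4NormQ, ← Real.rpow_natCast, ← Real.rpow_mul (integral_nonneg fun _ => by positivity)]
  norm_num

lemma L4NormQ_eq_lpNorm {d : ℕ} {u : EuclideanSpace ℝ (Fin d) → EuclideanSpace ℝ (Fin d)}
    (hu : Continuous u) : L4NormQ u = lpNorm u 4 (volume.restrict (unitCube d)) := by
  rw [lpNorm_eq_integral_norm_rpow_toReal (by norm_num) (by norm_num)
    hu.aestronglyMeasurable, L4NormQ]
  simp [← Real.rpow_ofNat]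

lemma L4NormQ_sub_comm {d : ℕ} (u v : EuclideanSpace ℝ (Fin d) → EuclideanSpace ℝ (Fin d)) :
    L4NormQ (fun x => u x - v x) = L4NormQ (fun x => v x - u x) := by
  simp only [L4NormQ, norm_sub_rev (u _)]

lemma L4NormQ_sub_le {d : ℕ} {u v : EuclideanSpace ℝ (Fin d) → EuclideanSpace ℝ (Fin d)}
    (hu : Continuous u) (hv : Continuous v) :
    L4NormQ u - L4NormQ v ≤ L4NormQ (fun x => u x - v x) := by
  rw [L4NormQ_eq_lpNorm hu, L4NormQ_eq_lpNorm hv, L4NormQ_eq_lpNorm (by fun_prop)]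
  have h := lpNorm_le_lpNorm_add_lpNorm_sub (f := u) (p := 4) (memLp_unitCube hv 4) (by norm_num)
  have e : (fun x => u x - v x) = u - v := rfl
  rw [e, lpNorm_sub_comm]
  linarith

/-- Hölder's inequality for the trilinear convective form. -/
lemma abs_integral_inner_convective_le {d : ℕ}
    {u v w : EuclideanSpace ℝ (Fin d) → EuclideanSpace ℝ (Fin d)}
    (hu : Continuous u) (hv : Continuous v) (hw : ContDiff ℝ 1 w) :
    |∫ x in unitCube d, ⟪fderiv ℝ w x (u x), v x⟫| ≤
      L4NormQ u * L4NormQ v * √(∫ x in unitCube d, frobSq (fderiv ℝ w x)) := by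
  have hdc : Continuous (fderiv ℝ w) := hw.continuous_fderiv one_ne_zero
  have hFc : Continuous fun x => √(frobSq (fderiv ℝ w x)) := (continuous_frobSq.comp hdc).sqrt
  have huvc : Continuous fun x => ‖u x‖ * ‖v x‖ := by fun_prop
  have hF : ∫ x in unitCube d, √(frobSq (fderiv ℝ w x)) ^ 2 =
      ∫ x in unitCube d, frobSq (fderiv ℝ w x) := by
    simp only [Real.sq_sqrt (frobSq_nonneg _)]
  have hpow : ∀ f : EuclideanSpace ℝ (Fin d) → EuclideanSpace ℝ (Fin d),
      √(∫ x in unitCube d, (‖f x‖ ^ 2) ^ 2) = L4NormQ f ^ 2 := by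
    intro f
    simp only [← pow_mul]
    rw [← L4NormQ_pow_four, show L4NormQ f ^ 4 = (L4NormQ f ^ 2) ^ 2 by ring,
      Real.sqrt_sq (sq_nonneg _)]
  have huv : √(∫ x in unitCube d, (‖u x‖ * ‖v x‖) ^ 2) ≤ L4NormQ u * L4NormQ v := by
    have h := integral_mul_le_sqrt_mul_sqrt (f := fun x => ‖u x‖ ^ 2) (g := fun x => ‖v x‖ ^ 2)
      (by fun_prop) (by fun_prop) (fun _ => by positivity) (fun _ => by positivity)
    rw [hpow, hpow] at h
    refine Real.sqrt_le_iff.2 ⟨mul_nonneg (L4NormQ_nonneg _) (L4NormQ_nonneg _), ?_⟩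
    simpa only [mul_pow] using h
  calc |∫ x in unitCube d, ⟪fderiv ℝ w x (u x), v x⟫|
      ≤ ∫ x in unitCube d, |⟪fderiv ℝ w x (u x), v x⟫| := abs_integral_le_integral_abs
    _ ≤ ∫ x in unitCube d, (‖u x‖ * ‖v x‖) * √(frobSq (fderiv ℝ w x)) := by
        refine setIntegral_mono (integrableOn_unitCube ((hdc.clm_apply hu).inner hv).abs)
          (integrableOn_unitCube (huvc.mul hFc)) fun x => ?_
        calc |⟪fderiv ℝ w x (u x), v x⟫| ≤ ‖fderiv ℝ w x (u x)‖ * ‖v x‖ :=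
              abs_real_inner_le_norm _ _
          _ ≤ √(frobSq (fderiv ℝ w x)) * ‖u x‖ * ‖v x‖ := by
              gcongr
              exact norm_apply_le_sqrt_frobSq_mul _ _
          _ = _ := by ring
    _ ≤ √(∫ x in unitCube d, (‖u x‖ * ‖v x‖) ^ 2) *
          √(∫ x in unitCube d, √(frobSq (fderiv ℝ w x)) ^ 2) :=
        integral_mul_le_sqrt_mul_sqrt huvc hFc (fun _ => by positivity)
          (fun _ => Real.sqrt_nonneg _)
    _ ≤ _ := by
        rw [hF]
        gcongr

lemma quantFactor_nonneg {d : ℕ} (N : ℕ)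
    (u : EuclideanSpace ℝ (Fin d) → EuclideanSpace ℝ (Fin d)) : 0 ≤ quantFactor N u := by
  have := L4NormQ_nonneg u
  unfold quantFactor
  split_ifs <;> positivity

lemma quantFactor_mul_L4NormQ_le {d : ℕ} (N : ℕ)
    (u : EuclideanSpace ℝ (Fin d) → EuclideanSpace ℝ (Fin d)) :
    quantFactor N u * L4NormQ u ≤ N := by
  unfold quantFactor
  split_ifs with h
  · simpa using h
  · have hN : (0 : ℝ) ≤ N := N.cast_nonneg
    have hu : 0 < L4NormQ u := hN.trans_lt (not_le.1 h)
    have hq : (N : ℝ) / L4NormQ u ≤ 1 := (div_le_one hu).2 (not_le.1 h).le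
    have hq0 : 0 ≤ (N : ℝ) / L4NormQ u := by positivity
    calc ((N : ℝ) / L4NormQ u) ^ 4 * L4NormQ u = ((N : ℝ) / L4NormQ u) ^ 3 * (N : ℝ) := by
          field_simp
      _ ≤ 1 * (N : ℝ) := by
          gcongr
          exact pow_le_one₀ hq0 hq
      _ = N := one_mul _

/-- The quantization factor is Lipschitz in the `L⁴` norm, with a quadratic gain. -/
lemma abs_quantFactor_sub_mul_sq_le {d : ℕ} (N : ℕ)
    {u v : EuclideanSpace ℝ (Fin d) → EuclideanSpace ℝ (Fin d)} (huv : L4NormQ u ≤ L4NormQ v) :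
    |quantFactor N u - quantFactor N v| * L4NormQ u ^ 2 ≤ 4 * N * (L4NormQ v - L4NormQ u) := by
  have hN : (0 : ℝ) ≤ N := N.cast_nonneg
  have ha : 0 ≤ L4NormQ u := L4NormQ_nonneg u
  unfold quantFactor
  generalize L4NormQ u = a at *
  generalize L4NormQ v = c at *
  generalize (N : ℝ) = n at *
  have key : ∀ {b : ℝ}, 0 ≤ b → b ≤ c → 0 < c → 1 - (b / c) ^ 4 ≤ 4 * ((c - b) / c) := by
    intro b hb hbc hc
    have h := one_add_mul_le_pow (a := b / c - 1) (by linarith [div_nonneg hb hc.le]) 4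
    have e : (c - b) / c = 1 - b / c := by field_simp
    rw [e]
    norm_num at h
    linarith
  split_ifs with h1 h2 h2
  · simp only [sub_self, abs_zero, zero_mul]
    exact mul_nonneg (by positivity) (by linarith)
  · have hnc := not_le.1 h2
    have hc : 0 < c := hN.trans_lt hnc
    have hq0 : 0 ≤ n / c := by positivity
    have hq1 : n / c ≤ 1 := (div_le_one hc).2 hnc.le
    rw [abs_of_nonneg (sub_nonneg.2 (pow_le_one₀ hq0 hq1))]
    calc (1 - (n / c) ^ 4) * a ^ 2 ≤ 4 * ((c - n) / c) * (n * c) := by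
          refine mul_le_mul (key hN hnc.le hc) (by nlinarith) (sq_nonneg _) ?_
          exact mul_nonneg (by norm_num) (div_nonneg (by linarith) hc.le)
      _ = 4 * n * (c - n) := by field_simp
      _ ≤ 4 * n * (c - a) := by gcongr
  · exact absurd (huv.trans h2) h1
  · have hna := not_le.1 h1
    have ha' : 0 < a := hN.trans_lt hna
    have hc : 0 < c := ha'.trans_le huv
    have hle : (n / c) ^ 4 ≤ (n / a) ^ 4 := by gcongr
    have hca : 0 ≤ c - a := sub_nonneg.2 huv
    rw [abs_of_nonneg (sub_nonneg.2 hle)]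
    calc ((n / a) ^ 4 - (n / c) ^ 4) * a ^ 2 = (n / a) ^ 4 * a ^ 2 * (1 - (a / c) ^ 4) := by
          field_simp
      _ ≤ (n / a) ^ 4 * a ^ 2 * (4 * ((c - a) / c)) := by
          gcongr
          exact key ha huv hc
      _ = 4 * n * (c - a) * ((n / a) ^ 2 * (n / c)) := by field_simp
      _ ≤ 4 * n * (c - a) * 1 := by
          gcongr
          refine mul_le_one₀ (pow_le_one₀ (by positivity) ((div_le_one ha').2 hna.le))
            (by positivity) ((div_le_one hc).2 (hna.le.trans huv))
      _ = _ := mul_one _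

lemma fderiv_fun_sub_apply {d : ℕ} {y z : EuclideanSpace ℝ (Fin d) → EuclideanSpace ℝ (Fin d)}
    (hy : ContDiff ℝ 1 y) (hz : ContDiff ℝ 1 z) (x : EuclideanSpace ℝ (Fin d)) :
    fderiv ℝ (fun x => y x - z x) x = fderiv ℝ y x - fderiv ℝ z x :=
  fderiv_fun_sub (hy.differentiable one_ne_zero x) (hz.differentiable one_ne_zero x)

lemma abs_quantized_convective_sub_le_of_le {d : ℕ} (N : ℕ)
    {y z : EuclideanSpace ℝ (Fin d) → EuclideanSpace ℝ (Fin d)}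
    (hy : ContDiff ℝ 1 y) (hz : ContDiff ℝ 1 z) (py : IsZdPeriodic y) (pz : IsZdPeriodic z)
    (dy : IsDivFree y) (dz : IsDivFree z) (hle : L4NormQ y ≤ L4NormQ z) :
    |quantFactor N y * (∫ x in unitCube d, ⟪fderiv ℝ y x (y x), y x - z x⟫)
        - quantFactor N z * (∫ x in unitCube d, ⟪fderiv ℝ z x (z x), y x - z x⟫)| ≤
      5 * N * (L4NormQ (fun x => y x - z x) *
        √(∫ x in unitCube d, frobSq (fderiv ℝ y x - fderiv ℝ z x))) := by
  have hD := fderiv_fun_sub_apply hy hz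
  have hw : ContDiff ℝ 1 fun x => y x - z x := hy.sub hz
  have pw : IsZdPeriodic fun x => y x - z x := fun x k => by simp only [py x k, pz x k]
  have dw : IsDivFree fun x => y x - z x := fun x => by
    simp only [hD, sub_apply, PiLp.sub_apply, Finset.sum_sub_distrib,
      dy x, dz x, sub_zero]
  have hc : ∀ {a b c : EuclideanSpace ℝ (Fin d) → EuclideanSpace ℝ (Fin d)}, Continuous a →
      ContDiff ℝ 1 b → Continuous c →
      IntegrableOn (fun x => ⟪fderiv ℝ b x (a x), c x⟫) (unitCube d) := fun ha hb hc =>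
    integrableOn_unitCube (((hb.continuous_fderiv one_ne_zero).clm_apply ha).inner hc)
  simp only [← hD]
  set w : EuclideanSpace ℝ (Fin d) → EuclideanSpace ℝ (Fin d) := fun x => y x - z x with hwdef
  set G := √(∫ x in unitCube d, frobSq (fderiv ℝ w x)) with hG
  have hG0 : 0 ≤ G := Real.sqrt_nonneg _
  set b₁ := ∫ x in unitCube d, ⟪fderiv ℝ y x (y x), w x⟫ with hb₁
  set b₂ := ∫ x in unitCube d, ⟪fderiv ℝ z x (z x), w x⟫ with hb₂
  have h₁ : |b₁| ≤ L4NormQ y ^ 2 * G := by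
    rw [hb₁, integral_inner_convective_swap hy hy hw py py pw dy, abs_neg, sq]
    exact abs_integral_inner_convective_le hy.continuous hy.continuous hw
  have hzero : ∫ x in unitCube d, ⟪fderiv ℝ w x (y x), w x⟫ = 0 := by
    linarith [integral_inner_convective_swap hy hw hw py pw pw dy]
  have hdiff : b₁ - b₂ = ∫ x in unitCube d, ⟪fderiv ℝ z x (w x), w x⟫ := by
    rw [← zero_add (∫ x in unitCube d, ⟪fderiv ℝ z x (w x), w x⟫), ← hzero, hb₁, hb₂,
      ← integral_sub (hc hy.continuous hy hw.continuous) (hc hz.continuous hz hw.continuous),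
      ← integral_add (hc hy.continuous hw hw.continuous) (hc hw.continuous hz hw.continuous)]
    refine integral_congr_ae (.of_forall fun x => ?_)
    simp only [hD, ← inner_sub_left, ← inner_add_left]
    congr 1
    simp only [hwdef, sub_apply, map_sub]
    abel
  have h₂ : |b₁ - b₂| ≤ L4NormQ w * L4NormQ z * G := by
    rw [hdiff, integral_inner_convective_swap hw hz hw pw pz pw dw, abs_neg]
    exact abs_integral_inner_convective_le hw.continuous hz.continuous hw
  have hA : L4NormQ z - L4NormQ y ≤ L4NormQ w :=
    (L4NormQ_sub_le hz.continuous hy.continuous).trans_eq (L4NormQ_sub_comm _ _)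
  have hN : (0 : ℝ) ≤ N := N.cast_nonneg
  have hw0 := L4NormQ_nonneg w
  have hq := quantFactor_nonneg N z
  calc |quantFactor N y * b₁ - quantFactor N z * b₂|
      = |(quantFactor N y - quantFactor N z) * b₁ + quantFactor N z * (b₁ - b₂)| := by
        congr 1; ring
    _ ≤ |quantFactor N y - quantFactor N z| * |b₁| + quantFactor N z * |b₁ - b₂| := by
        refine (abs_add_le _ _).trans_eq ?_
        rw [abs_mul, abs_mul, abs_of_nonneg hq]
    _ ≤ |quantFactor N y - quantFactor N z| * (L4NormQ y ^ 2 * G) +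
          quantFactor N z * (L4NormQ w * L4NormQ z * G) := by gcongr
    _ = (|quantFactor N y - quantFactor N z| * L4NormQ y ^ 2) * G +
          (quantFactor N z * L4NormQ z) * (L4NormQ w * G) := by ring
    _ ≤ (4 * N * L4NormQ w) * G + N * (L4NormQ w * G) := by
        refine add_le_add (mul_le_mul_of_nonneg_right ?_ hG0)
          (mul_le_mul_of_nonneg_right (quantFactor_mul_L4NormQ_le N z) (by positivity))
        exact (abs_quantFactor_sub_mul_sq_le N hle).trans (by gcongr)
    _ = _ := by ring

lemma abs_quantized_convective_sub_le {d : ℕ} (N : ℕ)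
    {y z : EuclideanSpace ℝ (Fin d) → EuclideanSpace ℝ (Fin d)}
    (hy : ContDiff ℝ 1 y) (hz : ContDiff ℝ 1 z) (py : IsZdPeriodic y) (pz : IsZdPeriodic z)
    (dy : IsDivFree y) (dz : IsDivFree z) :
    |quantFactor N y * (∫ x in unitCube d, ⟪fderiv ℝ y x (y x), y x - z x⟫)
        - quantFactor N z * (∫ x in unitCube d, ⟪fderiv ℝ z x (z x), y x - z x⟫)| ≤
      5 * N * (L4NormQ (fun x => y x - z x) *
        √(∫ x in unitCube d, frobSq (fderiv ℝ y x - fderiv ℝ z x))) := by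
  rcases le_total (L4NormQ y) (L4NormQ z) with hle | hle
  · exact abs_quantized_convective_sub_le_of_le N hy hz py pz dy dz hle
  · have h := abs_quantized_convective_sub_le_of_le N hz hy pz py dz dy hle
    have hneg : ∀ a : EuclideanSpace ℝ (Fin d) → EuclideanSpace ℝ (Fin d),
        ∫ x in unitCube d, ⟪a x, z x - y x⟫ = -∫ x in unitCube d, ⟪a x, y x - z x⟫ := fun a => by
      rw [← integral_neg]
      simp only [← inner_neg_right, neg_sub]
    have hfrob : ∀ x, frobSq (fderiv ℝ z x - fderiv ℝ y x) =
        frobSq (fderiv ℝ y x - fderiv ℝ z x) := fun x => by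
      simp only [frobSq, sub_apply, norm_sub_rev (fderiv ℝ z x _)]
    rw [hneg, hneg, L4NormQ_sub_comm] at h
    simp only [hfrob] at h
    refine le_trans (le_of_eq ?_) h
    congr 1
    ring

/-- Young-type absorption for an interpolation inequality. -/
lemma exists_mul_le_add_of_pow_four_le {ε : ℝ} (hε : 0 < ε) :
    ∃ C > (0 : ℝ), ∀ A W G : ℝ, 0 ≤ A → 0 ≤ W → 0 ≤ G → A ^ 4 ≤ W * (W + 4 * G) ^ 3 →
      A * G ≤ ε * G ^ 2 + C * W ^ 2 := by
  set c : ℝ := min 1 (ε ^ 4 / 125) with hc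
  have hc0 : 0 < c := lt_min one_pos (by positivity)
  have hc1 : c ≤ 1 := min_le_left _ _
  have hcε : c * 125 ≤ ε ^ 4 := by
    have : c ≤ ε ^ 4 / 125 := min_le_right _ _
    linarith
  refine ⟨(1 + 4 / c) / c, by positivity, fun A W G hA hW hG h => ?_⟩
  rcases le_total W (c * G) with hWG | hWG
  · have hAε : A ≤ ε * G := by
      refine le_of_pow_le_pow_left₀ (n := 4) (by norm_num) (by positivity) ?_
      calc A ^ 4 ≤ W * (W + 4 * G) ^ 3 := h
        _ ≤ (c * G) * (1 * G + 4 * G) ^ 3 := by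
            gcongr
            exact hWG.trans (by gcongr)
        _ = c * 125 * G ^ 4 := by ring
        _ ≤ ε ^ 4 * G ^ 4 := by gcongr
        _ = (ε * G) ^ 4 := by ring
    calc A * G ≤ ε * G * G := by gcongr
      _ = ε * G ^ 2 := by ring
      _ ≤ _ := le_add_of_nonneg_right (by positivity)
  · have hGW : G ≤ W / c := (le_div_iff₀ hc0).2 (by linarith)
    have hAW : A ≤ (1 + 4 / c) * W := by
      refine le_of_pow_le_pow_left₀ (n := 4) (by norm_num) (by positivity) ?_
      have h1 : W ≤ (1 + 4 / c) * W := le_mul_of_one_le_left hW (by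
        have : 0 < 4 / c := by positivity
        linarith)
      calc A ^ 4 ≤ W * (W + 4 * G) ^ 3 := h
        _ ≤ ((1 + 4 / c) * W) * (W + 4 * (W / c)) ^ 3 := by gcongr
        _ = ((1 + 4 / c) * W) ^ 4 := by ring
    calc A * G ≤ ((1 + 4 / c) * W) * (W / c) := by gcongr
      _ = (1 + 4 / c) / c * W ^ 2 := by ring
      _ ≤ _ := le_add_of_nonneg_left (by positivity)

/-- Lemma A.1 of the paper (the quantized-nonlinearity estimate): for
`d ∈ {2,3}`, `μ > 0` and `N ∈ ℕ`, there is a constant `C > 0` (depending only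
on `d`, `μ`, `N`) such that for all smooth `ℤ^d`-periodic divergence-free
`y, z`,
`|θ_N(y)∫⟨(y·∇)y, y−z⟩ − θ_N(z)∫⟨(z·∇)z, y−z⟩|
  ≤ (μ/2)∫‖Dy−Dz‖_F² + C∫‖y−z‖²` over `Q = [0,1]^d`. -/
theorem quantized_convective_estimate (d : ℕ) (hd : d = 2 ∨ d = 3)
    (μ : ℝ) (hμ : 0 < μ) (N : ℕ) :
    ∃ C > (0 : ℝ),
      ∀ y z : EuclideanSpace ℝ (Fin d) → EuclideanSpace ℝ (Fin d),
        ContDiff ℝ (⊤ : ℕ∞) y → ContDiff ℝ (⊤ : ℕ∞) z →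
        IsZdPeriodic y → IsZdPeriodic z →
        IsDivFree y → IsDivFree z →
        |quantFactor N y * (∫ x in unitCube d, ⟪fderiv ℝ y x (y x), y x - z x⟫)
          - quantFactor N z * (∫ x in unitCube d, ⟪fderiv ℝ z x (z x), y x - z x⟫)| ≤
          (μ / 2) * (∫ x in unitCube d, frobSq (fderiv ℝ y x - fderiv ℝ z x))
            + C * ∫ x in unitCube d, ‖y x - z x‖ ^ 2 := by
  have hN : (0 : ℝ) ≤ N := N.cast_nonneg
  obtain ⟨C, hC, hY⟩ := exists_mul_le_add_of_pow_four_le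
    (ε := μ / (2 * (5 * N + 1))) (by positivity)
  refine ⟨(5 * N + 1) * C, by positivity, fun y z hy hz py pz dy dz => ?_⟩
  have hy1 : ContDiff ℝ 1 y := hy.of_le (by exact_mod_cast le_top)
  have hz1 : ContDiff ℝ 1 z := hz.of_le (by exact_mod_cast le_top)
  have hlad := integral_norm_pow_four_le hd (hy1.sub hz1)
  simp only [fderiv_fun_sub_apply hy1 hz1] at hlad
  rw [← L4NormQ_pow_four (fun x => y x - z x)] at hlad
  have hfin := hY _ _ _ (L4NormQ_nonneg _) (Real.sqrt_nonneg _) (Real.sqrt_nonneg _) hlad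
  rw [Real.sq_sqrt (integral_nonneg fun _ => frobSq_nonneg _),
    Real.sq_sqrt (integral_nonneg fun _ => sq_nonneg _)] at hfin
  refine (abs_quantized_convective_sub_le N hy1 hz1 py pz dy dz).trans ?_
  have hAG : 0 ≤ L4NormQ (fun x => y x - z x) *
      √(∫ x in unitCube d, frobSq (fderiv ℝ y x - fderiv ℝ z x)) :=
    mul_nonneg (L4NormQ_nonneg _) (Real.sqrt_nonneg _)
  calc _ ≤ (5 * (N : ℝ) + 1) * (L4NormQ (fun x => y x - z x) *
        √(∫ x in unitCube d, frobSq (fderiv ℝ y x - fderiv ℝ z x))) := by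
        gcongr
        linarith
    _ ≤ (5 * (N : ℝ) + 1) * _ := mul_le_mul_of_nonneg_left hfin (by positivity)
    _ = _ := by field_simp

end
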